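/- Suppose M is a 4×4 positive semidefinite matrix such that for every pair of distinct states |ψ⟩, |ψ'⟩ in the set S₅ the post-measurement orthogonality condition ⟨ψ|(M⊗I)|ψ'⟩ = 0 holds. Then M = diag(δ₀, γ, γ, γ) in the computational basis for some δ₀, γ ≥ 0. -/

import Mathlib

open scoped BigOperators ComplexOrder

noncomputable section

def e4 (i : Fin 4) : Fin 4 → ℂ := fun j => if j = i then 1 else 0
def p4 (i j : Fin 4) : Fin 4 → ℂ := ((Real.sqrt 2 : ℂ))⁻¹ • (e4 i + e4 j)
def m4 (i j : Fin 4) : Fin 4 → ℂ := ((Real.sqrt 2 : ℂ))⁻¹ • (e4 i - e4 j)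
/-- Tensor product of two vectors of ℂ⁴, as a vector of ℂ⁴⊗ℂ⁴. -/
def tpT4 (a b : Fin 4 → ℂ) : Fin 4 × Fin 4 → ℂ := fun x => a x.1 * b x.2
/-- Inner product on ℂ⁴⊗ℂ⁴. -/
def dotT4 (x y : Fin 4 × Fin 4 → ℂ) : ℂ := ∑ p, star (x p) * y p

/-- The states of the set `S₅ ⊂ ℂ⁴⊗ℂ⁴` (entangled and product, unnormalized). -/
def S5 : Fin 12 → (Fin 4 × Fin 4 → ℂ) :=
  ![tpT4 (e4 0) (p4 0 1) + tpT4 (e4 2) (p4 2 3),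
    tpT4 (e4 0) (m4 0 1) + tpT4 (e4 2) (m4 2 3),
    tpT4 (e4 0) (p4 2 3),
    tpT4 (e4 0) (m4 2 3),
    tpT4 (e4 1 + e4 2) (e4 0) + tpT4 (e4 3) (e4 2),
    tpT4 (e4 1 - e4 2) (e4 0),
    tpT4 (e4 3) (e4 0),
    tpT4 (e4 1) (p4 1 2) + tpT4 (e4 3) (e4 3),
    tpT4 (e4 1) (m4 1 2),
    tpT4 (e4 1) (e4 3),
    tpT4 (e4 2 + e4 3) (e4 1),
    tpT4 (e4 2 - e4 3) (e4 1)]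

/-- Action of `M ⊗ I` on ℂ⁴⊗ℂ⁴, `M` acting on the first (Alice) factor. -/
def MI (M : Matrix (Fin 4) (Fin 4) ℂ) (w : Fin 4 × Fin 4 → ℂ) : Fin 4 × Fin 4 → ℂ :=
  fun x => ∑ k, M x.1 k * w (k, x.2)

/-- if a PSD matrix `M` on Alice's side preserves the orthogonality of the
set `S₅`, i.e. `⟨ψ|(M⊗I)|ψ'⟩ = 0` for all distinct `ψ, ψ' ∈ S₅`, then
`M = diag(δ₀, γ, γ, γ)` with `δ₀, γ ≥ 0`. -/
theorem stmt9 (M : Matrix (Fin 4) (Fin 4) ℂ) (hM : M.PosSemidef)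
    (h : ∀ i j : Fin 12, i ≠ j → dotT4 (S5 i) (MI M (S5 j)) = 0) :
    ∃ δ γ : ℝ, 0 ≤ δ ∧ 0 ≤ γ ∧
      M = Matrix.diagonal ![(δ : ℂ), (γ : ℂ), (γ : ℂ), (γ : ℂ)] := by
  have h10_11 := h 10 11 (by decide)
  have h9_7 := h 9 7 (by decide)
  have h7_9 := h 7 9 (by decide)
  have h0_9 := h 0 9 (by decide)
  have h9_0 := h 9 0 (by decide)
  have h2_9 := h 2 9 (by decide)
  have h9_2 := h 9 2 (by decide)
  have h6_0 := h 6 0 (by decide)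
  have h0_6 := h 0 6 (by decide)
  have h0_2 := h 0 2 (by decide)
  have h2_0 := h 2 0 (by decide)
  have h5_6 := h 5 6 (by decide)
  have h6_5 := h 6 5 (by decide)
  have h4_5 := h 4 5 (by decide)
  simp [S5, dotT4, MI, tpT4, e4, p4, m4, Fintype.sum_prod_type, Fin.sum_univ_four]
    at h10_11 h9_7 h7_9 h0_9 h9_0 h2_9 h9_2 h6_0 h0_6 h0_2 h2_0 h5_6 h6_5 h4_5
  have m23 : M 2 3 = 0 := by linear_combination h9_7 - h5_6
  have m32 : M 3 2 = 0 := by linear_combination h7_9 - h6_5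
  have m11 : M 1 1 = M 2 2 := by linear_combination h4_5 + h9_0 - h0_9
  have m33 : M 3 3 = M 2 2 := by linear_combination m32 - m23 - h10_11
  have real_diag (i : Fin 4) : 0 ≤ (M i i).re ∧ ((M i i).re : ℂ) = M i i := by
    obtain ⟨hre, him⟩ := Complex.nonneg_iff.mp (hM.diag_nonneg (i := i))
    exact ⟨hre, Complex.ext (by simp) (by simpa using him)⟩
  refine ⟨(M 0 0).re, (M 2 2).re, (real_diag 0).1, (real_diag 2).1, ?_⟩
  rw [(real_diag 0).2, (real_diag 2).2]
  ext i j
  fin_cases i <;> fin_cases j <;> simp [*]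

end
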